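/- Let R be a commutative local ring, J an ideal of R, and r ∈ R with J ⊆ ⟨r⟩ but r ∉ J. If r2 ∈ R satisfies J + ⟨r2⟩ = ⟨r⟩, then r2 is a unit multiple of r, i.e. there exists a unit u ∈ R with r2 = u * r. -/

import Mathlib

theorem stmt_1 {R : Type*} [CommRing R] [IsLocalRing R] (J : Ideal R) (r : R)
    (hJr : J ≤ Ideal.span {r}) (hrJ : r ∉ J) (r2 : R)
    (h : J ⊔ Ideal.span {r2} = Ideal.span {r}) :
    ∃ u : R, IsUnit u ∧ r2 = u * r := by
  have h2 : r2 ∈ Ideal.span {r} := by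
    rw [← h]
    exact Ideal.mem_sup_right (Ideal.mem_span_singleton_self r2)
  obtain ⟨a, ha⟩ := Ideal.mem_span_singleton'.1 h2
  have h1 : r ∈ J ⊔ Ideal.span {r2} := by
    rw [h]
    exact Ideal.mem_span_singleton_self r
  obtain ⟨j, hj, y, hy, hjy⟩ := Submodule.mem_sup.1 h1
  obtain ⟨b, hb⟩ := Ideal.mem_span_singleton'.1 hy
  refine ⟨a, ?_, ha.symm⟩
  rcases IsLocalRing.isUnit_or_isUnit_one_sub_self (b * a) with hu | hu
  · exact isUnit_of_mul_isUnit_right hu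
  · exfalso
    apply hrJ
    have hj' : (1 - b * a) * r = j := by
      linear_combination (-b) * ha - hb - hjy
    rw [← hj'] at hj
    exact (Ideal.unit_mul_mem_iff_mem J hu).1 hj
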